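/- arXiv:math/0303068 — 2 statements merged into one kernel-verified Lean document; each statement's English description precedes it below -/
import Mathlib

section
/- Under the standing assumptions, for all p ≥ 1, q ≥ 0 and 1 ≤ i ≤ p−1, the operators on H^{⊗(p+1)}⊗A^{⊗(q+1)} satisfy d_i ∘ t = t ∘ d_{i−1}, where t(g_0,…,g_p | a_0,…,a_q) = (g_p^{(q+2)}, g_0,…,g_{p−1} | g_p⁽¹⁾(a_0),…,g_p^{(q+1)}(a_q)) and d_i(g_0,…,g_p | a_0,…,a_q) = (g_0,…,g_i⁽¹⁾g_{i+1}⁽¹⁾,…,g_p | σ(g_i⁽²⁾,g_{i+1}⁽²⁾)a_0, a_1,…,a_q) for 0 ≤ i < p. -/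
open TensorProduct

noncomputable section

/-! ## Tensor powers, iterated comultiplication and Sweedler representations -/

/-- `Tpow k V n` is the `(n+1)`-fold tensor power `V ⊗ V ⊗ ⋯ ⊗ V` (`n+1` factors),
bundled as an object of `ModuleCat k`. -/
def Tpow (k : Type) [Field k] (V : Type) [AddCommGroup V] [Module k V] : ℕ → ModuleCat k
  | 0 => ModuleCat.of k V
  | n + 1 => ModuleCat.of k (V ⊗[k] (Tpow k V n))

/-- The elementary tensor `f 0 ⊗ f 1 ⊗ ⋯ ⊗ f n` in `Tpow k V n`. -/
def tpow (k : Type) [Field k] (V : Type) [AddCommGroup V] [Module k V] :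
    (n : ℕ) → (Fin (n + 1) → V) → Tpow k V n
  | 0, f => (f 0 : V)
  | n + 1, f => (f 0 ⊗ₜ[k] tpow k V n (fun i => f i.succ) : V ⊗[k] Tpow k V n)

/-- The iterated comultiplication `Δ⁽ⁿ⁾ : H → H^{⊗(n+1)}`, `Δ⁽⁰⁾ = id`,
`Δ⁽ⁿ⁺¹⁾ = (1 ⊗ Δ⁽ⁿ⁾) ∘ Δ`. -/
def comulIter (k : Type) [Field k] (H : Type) [Ring H] [HopfAlgebra k H] :
    (n : ℕ) → H →ₗ[k] Tpow k H n
  | 0 => LinearMap.id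
  | n + 1 =>
    (LinearMap.lTensor H (comulIter k H n) ∘ₗ Coalgebra.comul :
      H →ₗ[k] (H ⊗[k] Tpow k H n))

/-- A finite Sweedler-type representation `Δ⁽ⁿ⁾ h = ∑ᵢ h⁽¹⁾ᵢ ⊗ ⋯ ⊗ h⁽ⁿ⁺¹⁾ᵢ` of the iterated
comultiplication of `h`; `leg i j` is the `(j+1)`-st Sweedler leg of the `i`-th summand. -/
structure IterRepr (k : Type) [Field k] (H : Type) [Ring H] [HopfAlgebra k H]
    (n : ℕ) (h : H) where
  ι : Type
  s : Finset ι
  leg : ι → Fin (n + 1) → H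
  eq : ∑ i ∈ s, tpow k H n (leg i) = comulIter k H n h

/-- Merge an `(n+1)`-tuple to an `n`-tuple, replacing the two entries at positions `i, i+1`
by the single entry `v`. -/
def mergeAt {V : Type} {n : ℕ} (i : Fin n) (x : Fin (n + 1) → V) (v : V) :
    Fin n → V :=
  fun j => if (j : ℕ) < (i : ℕ) then x (Fin.castSucc j) else
    if (j : ℕ) = (i : ℕ) then v else x j.succ

variable (k : Type) [Field k] (H : Type) [Ring H] [HopfAlgebra k H]

/-- `H` is cocommutative. -/
def Cocomm : Prop :=
  ∀ h : H, (TensorProduct.comm k H H) (Coalgebra.comul (R := k) h) = Coalgebra.comul (R := k) h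

variable (A : Type) [Ring A] [Algebra k A]
variable (rho : H →ₗ[k] A →ₗ[k] A)

/-- `rho` is a weak action of `H` on `A`:
`h(ab) = h⁽¹⁾(a)h⁽²⁾(b)`, `h(1) = ε(h)1` and `1(a) = a`. -/
def IsWeakAction : Prop :=
  (∀ (h : H) (a b : A) (R : IterRepr k H 1 h),
      rho h (a * b) = ∑ i ∈ R.s, rho (R.leg i 0) a * rho (R.leg i 1) b) ∧
  (∀ h : H, rho h (1 : A) = Coalgebra.counit (R := k) h • (1 : A)) ∧
  (∀ a : A, rho 1 a = a)

/-- `rho` makes `A` a left `H`-module algebra: a weak action which is an action. -/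
def IsModuleAlgebraAction : Prop :=
  IsWeakAction k H A rho ∧ (∀ (h l : H) (a : A), rho (h * l) a = rho h (rho l a))

variable (sg : H →ₗ[k] H →ₗ[k] k)

/-- Normality for a `k`-valued cocycle: `σ(h,1) = σ(1,h) = ε(h)`. -/
def NormalK : Prop :=
  ∀ h : H, sg h 1 = Coalgebra.counit (R := k) h ∧ sg 1 h = Coalgebra.counit (R := k) h

/-- The cocycle property for a `k`-valued cocycle:
`σ(l⁽¹⁾,m⁽¹⁾)σ(h,l⁽²⁾m⁽²⁾) = σ(h⁽¹⁾,l⁽¹⁾)σ(h⁽²⁾l⁽²⁾,m)`. -/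
def CocycleK : Prop :=
  ∀ (h l m : H) (Rh : IterRepr k H 1 h) (Rl : IterRepr k H 1 l) (Rm : IterRepr k H 1 m),
    ∑ j ∈ Rl.s, ∑ c ∈ Rm.s,
        sg (Rl.leg j 0) (Rm.leg c 0) * sg h (Rl.leg j 1 * Rm.leg c 1) =
      ∑ i ∈ Rh.s, ∑ j ∈ Rl.s,
        sg (Rh.leg i 0) (Rl.leg j 0) * sg (Rh.leg i 1 * Rl.leg j 1) m

/-- The twisted module property for a `k`-valued cocycle:
`h⁽¹⁾(l⁽¹⁾(a))σ(h⁽²⁾,l⁽²⁾) = σ(h⁽¹⁾,l⁽¹⁾)(h⁽²⁾l⁽²⁾)(a)`. -/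
def TwistedModuleK : Prop :=
  ∀ (h l : H) (a : A) (Rh : IterRepr k H 1 h) (Rl : IterRepr k H 1 l),
    ∑ i ∈ Rh.s, ∑ j ∈ Rl.s,
        sg (Rh.leg i 1) (Rl.leg j 1) • rho (Rh.leg i 0) (rho (Rl.leg j 0) a) =
      ∑ i ∈ Rh.s, ∑ j ∈ Rl.s,
        sg (Rh.leg i 0) (Rl.leg j 0) • rho (Rh.leg i 1 * Rl.leg j 1) a

/-- The `k`-valued map `σ`, viewed in the convolution algebra `Hom_k(H ⊗ H, A)` via
`x ⊗ y ↦ σ(x,y)1_A`, is convolution invertible. -/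
def ConvInvertibleK : Prop :=
  ∃ sg' : H →ₗ[k] H →ₗ[k] A,
    ∀ (h l : H) (Rh : IterRepr k H 1 h) (Rl : IterRepr k H 1 l),
      (∑ i ∈ Rh.s, ∑ j ∈ Rl.s,
          (sg (Rh.leg i 0) (Rl.leg j 0) • (1 : A)) * sg' (Rh.leg i 1) (Rl.leg j 1) =
        (Coalgebra.counit (R := k) h * Coalgebra.counit (R := k) l) • (1 : A)) ∧
      (∑ i ∈ Rh.s, ∑ j ∈ Rl.s,
          sg' (Rh.leg i 0) (Rl.leg j 0) * (sg (Rh.leg i 1) (Rl.leg j 1) • (1 : A)) =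
        (Coalgebra.counit (R := k) h * Coalgebra.counit (R := k) l) • (1 : A))

/-- Normality, as an identity in `A`: `σ(h,1) = σ(1,h) = ε(h)1_A`. -/
def NormalKA : Prop :=
  ∀ h : H, sg h 1 • (1 : A) = Coalgebra.counit (R := k) h • (1 : A) ∧
    sg 1 h • (1 : A) = Coalgebra.counit (R := k) h • (1 : A)

/-- The cocycle property, as an identity in `A` (values of `σ` lie in `k·1_A`):
`σ(l⁽¹⁾,m⁽¹⁾)σ(h,l⁽²⁾m⁽²⁾) = σ(h⁽¹⁾,l⁽¹⁾)σ(h⁽²⁾l⁽²⁾,m)`. -/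
def CocycleKA : Prop :=
  ∀ (h l m : H) (Rh : IterRepr k H 1 h) (Rl : IterRepr k H 1 l) (Rm : IterRepr k H 1 m),
    ∑ j ∈ Rl.s, ∑ c ∈ Rm.s,
        (sg (Rl.leg j 0) (Rm.leg c 0) * sg h (Rl.leg j 1 * Rm.leg c 1)) • (1 : A) =
      ∑ i ∈ Rh.s, ∑ j ∈ Rl.s,
        (sg (Rh.leg i 0) (Rl.leg j 0) * sg (Rh.leg i 1 * Rl.leg j 1) m) • (1 : A)

/-! ## The operators of the cylindrical module `A ♮_σ H` -/

/-- Spec of the horizontal face `dᵢ` (`0 ≤ i < P`) on `H^{⊗(P+1)} ⊗ A^{⊗(q+1)}`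
(here `P = p+1`):
`dᵢ(g₀,…,g_P | a₀,…,a_q) = (g₀,…,gᵢ⁽¹⁾g_{i+1}⁽¹⁾,…,g_P | σ(gᵢ⁽²⁾,g_{i+1}⁽²⁾)a₀, a₁,…,a_q)`. -/
def IsHorFace (p q : ℕ) (i : Fin (p + 1))
    (D : ((Tpow k H (p + 1) : Type) ⊗[k] (Tpow k A q : Type)) →ₗ[k]
      ((Tpow k H p : Type) ⊗[k] (Tpow k A q : Type))) : Prop :=
  ∀ (g : Fin (p + 2) → H) (a : Fin (q + 1) → A)
    (R : IterRepr k H 1 (g i.castSucc)) (S : IterRepr k H 1 (g i.succ)),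
    D (tpow k H (p + 1) g ⊗ₜ[k] tpow k A q a) =
      ∑ r ∈ R.s, ∑ s ∈ S.s,
        tpow k H p (mergeAt i g (R.leg r 0 * S.leg s 0)) ⊗ₜ[k]
          tpow k A q (Function.update a 0 (sg (R.leg r 1) (S.leg s 1) • a 0))

/-- Spec of the last horizontal face `d_P` on `H^{⊗(P+1)} ⊗ A^{⊗(q+1)}` (here `P = p+1`):
`d_P(g₀,…,g_P | a₀,…,a_q) = (g_P^{(q+2)}g₀⁽¹⁾, g₁,…,g_{P−1} |
σ(g_P^{(q+3)},g₀⁽²⁾)g_P⁽¹⁾(a₀), g_P⁽²⁾(a₁),…,g_P^{(q+1)}(a_q))`. -/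
def IsLastHorFace (p q : ℕ)
    (D : ((Tpow k H (p + 1) : Type) ⊗[k] (Tpow k A q : Type)) →ₗ[k]
      ((Tpow k H p : Type) ⊗[k] (Tpow k A q : Type))) : Prop :=
  ∀ (g : Fin (p + 2) → H) (a : Fin (q + 1) → A)
    (R : IterRepr k H (q + 2) (g (Fin.last (p + 1)))) (S : IterRepr k H 1 (g 0)),
    D (tpow k H (p + 1) g ⊗ₜ[k] tpow k A q a) =
      ∑ r ∈ R.s, ∑ s ∈ S.s,
        tpow k H p
          (Fin.cases (R.leg r ⟨q + 1, by omega⟩ * S.leg s 0)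
            (fun j : Fin p => g j.succ.castSucc)) ⊗ₜ[k]
        tpow k A q (fun c : Fin (q + 1) =>
          if c = 0 then
            sg (R.leg r ⟨q + 2, by omega⟩) (S.leg s 1) • rho (R.leg r 0) (a 0)
          else rho (R.leg r (Fin.castLE (by omega) c)) (a c))

/-- Spec of the horizontal cyclic operator `t` on `H^{⊗(p+1)} ⊗ A^{⊗(q+1)}`:
`t(g₀,…,g_p | a₀,…,a_q) = (g_p^{(q+2)}, g₀,…,g_{p−1} | g_p⁽¹⁾(a₀),…,g_p^{(q+1)}(a_q))`. -/
def IsCycT (p q : ℕ)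
    (T : ((Tpow k H p : Type) ⊗[k] (Tpow k A q : Type)) →ₗ[k]
      ((Tpow k H p : Type) ⊗[k] (Tpow k A q : Type))) : Prop :=
  ∀ (g : Fin (p + 1) → H) (a : Fin (q + 1) → A)
    (R : IterRepr k H (q + 1) (g (Fin.last p))),
    T (tpow k H p g ⊗ₜ[k] tpow k A q a) =
      ∑ r ∈ R.s,
        tpow k H p (Fin.cases (R.leg r (Fin.last (q + 1))) (fun j : Fin p => g j.castSucc))
          ⊗ₜ[k]
        tpow k A q (fun c : Fin (q + 1) => rho (R.leg r c.castSucc) (a c))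

/-- Spec of the vertical cyclic operator `τ` on `H^{⊗(p+1)} ⊗ A^{⊗(q+1)}`:
`τ(g₀,…,g_p | a₀,…,a_q) = (g₀⁽²⁾,…,g_p⁽²⁾ | S(g₀⁽¹⁾⋯g_p⁽¹⁾)(a_q), a₀,…,a_{q−1})`. -/
def IsCycTau (p q : ℕ)
    (T : ((Tpow k H p : Type) ⊗[k] (Tpow k A q : Type)) →ₗ[k]
      ((Tpow k H p : Type) ⊗[k] (Tpow k A q : Type))) : Prop :=
  ∀ (g : Fin (p + 1) → H) (a : Fin (q + 1) → A)
    (R : ∀ i : Fin (p + 1), IterRepr k H 1 (g i)),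
    T (tpow k H p g ⊗ₜ[k] tpow k A q a) =
      ∑ e ∈ Fintype.piFinset (fun i => (R i).s),
        tpow k H p (fun i => (R i).leg (e i) 1) ⊗ₜ[k]
        tpow k A q
          (Fin.cases
            (rho (HopfAlgebra.antipode (R := k)
                ((List.ofFn (fun i : Fin (p + 1) => (R i).leg (e i) 0)).prod))
              (a (Fin.last q)))
            (fun c : Fin q => a c.castSucc))

/-- Spec of the vertical face `δᵢ` (`0 ≤ i < Q`) on `H^{⊗(p+1)} ⊗ A^{⊗(Q+1)}`
(here `Q = q+1`): `δᵢ(g | a₀,…,a_Q) = (g | a₀,…,aᵢa_{i+1},…,a_Q)`. -/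
def IsVerFace (p q : ℕ) (i : Fin (q + 1))
    (D : ((Tpow k H p : Type) ⊗[k] (Tpow k A (q + 1) : Type)) →ₗ[k]
      ((Tpow k H p : Type) ⊗[k] (Tpow k A q : Type))) : Prop :=
  ∀ (g : Fin (p + 1) → H) (a : Fin (q + 2) → A),
    D (tpow k H p g ⊗ₜ[k] tpow k A (q + 1) a) =
      tpow k H p g ⊗ₜ[k] tpow k A q (mergeAt i a (a i.castSucc * a i.succ))

/-- Spec of the last vertical face `δ_Q` on `H^{⊗(p+1)} ⊗ A^{⊗(Q+1)}` (here `Q = q+1`):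
`δ_Q(g₀,…,g_p | a₀,…,a_Q) = (g₀⁽²⁾,…,g_p⁽²⁾ | S(g₀⁽¹⁾⋯g_p⁽¹⁾)(a_Q)a₀, a₁,…,a_{Q−1})`. -/
def IsLastVerFace (p q : ℕ)
    (D : ((Tpow k H p : Type) ⊗[k] (Tpow k A (q + 1) : Type)) →ₗ[k]
      ((Tpow k H p : Type) ⊗[k] (Tpow k A q : Type))) : Prop :=
  ∀ (g : Fin (p + 1) → H) (a : Fin (q + 2) → A)
    (R : ∀ i : Fin (p + 1), IterRepr k H 1 (g i)),
    D (tpow k H p g ⊗ₜ[k] tpow k A (q + 1) a) =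
      ∑ e ∈ Fintype.piFinset (fun i => (R i).s),
        tpow k H p (fun i => (R i).leg (e i) 1) ⊗ₜ[k]
        tpow k A q
          (Fin.cases
            (rho (HopfAlgebra.antipode (R := k)
                ((List.ofFn (fun i : Fin (p + 1) => (R i).leg (e i) 0)).prod))
              (a (Fin.last (q + 1))) * a 0)
            (fun c : Fin q => a c.succ.castSucc))

theorem exists_list_sum_tpow (k : Type) [Field k] (V : Type) [AddCommGroup V] [Module k V]
    (n : ℕ) (x : Tpow k V n) :
    ∃ l : List (Fin (n + 1) → V), (l.map (tpow k V n)).sum = x := by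
  induction n with
  | zero => exact ⟨[fun _ => x], List.sum_singleton⟩
  | succ n ih =>
    change V ⊗[k] Tpow k V n at x
    change ∃ l : List (Fin (n + 2) → V),
      (l.map (fun f => (f 0 ⊗ₜ[k] tpow k V n (fun i => f i.succ) : V ⊗[k] Tpow k V n))).sum = x
    induction x using TensorProduct.induction_on with
    | zero => exact ⟨[], rfl⟩
    | tmul v y =>
      obtain ⟨l, rfl⟩ := ih y
      refine ⟨l.map (Fin.cons v), ?_⟩
      induction l with
      | nil => simp
      | cons f l ihl =>
        simp only [List.map_cons, List.sum_cons, ihl, TensorProduct.tmul_add]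
        rfl
    | add x y hx hy =>
      obtain ⟨l, rfl⟩ := hx
      obtain ⟨l', rfl⟩ := hy
      exact ⟨l ++ l', by simp⟩

theorem IterRepr.nonempty (k : Type) [Field k] (H : Type) [Ring H] [HopfAlgebra k H]
    (n : ℕ) (h : H) : Nonempty (IterRepr k H n h) := by
  obtain ⟨l, hl⟩ := exists_list_sum_tpow k H n (comulIter k H n h)
  refine ⟨⟨Fin l.length, Finset.univ, l.get, ?_⟩⟩
  rw [← hl, ← List.sum_ofFn]
  congr 1
  apply List.ext_get <;> simp

theorem Tpow.hom_ext_tmul (k : Type) [Field k] {V W M : Type} [AddCommGroup V] [Module k V]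
    [AddCommGroup W] [Module k W] [AddCommGroup M] [Module k M] {p q : ℕ}
    {F G : ((Tpow k V p : Type) ⊗[k] (Tpow k W q : Type)) →ₗ[k] M}
    (h : ∀ v w, F (tpow k V p v ⊗ₜ[k] tpow k W q w) = G (tpow k V p v ⊗ₜ[k] tpow k W q w)) :
    F = G := by
  apply TensorProduct.ext'
  intro x y
  obtain ⟨l, rfl⟩ := exists_list_sum_tpow k V p x
  obtain ⟨m, rfl⟩ := exists_list_sum_tpow k W q y
  induction l with
  | nil => simp
  | cons f l ihl =>
    simp only [List.map_cons, List.sum_cons, TensorProduct.add_tmul, map_add, ihl]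
    congr 1
    clear ihl
    induction m with
    | nil => simp
    | cons g m ihm =>
      simp only [List.map_cons, List.sum_cons, TensorProduct.tmul_add, map_add, ihm, h]

/-- Transport of a Sweedler representation along an equality of elements. -/
def IterRepr.copy {k : Type} [Field k] {H : Type} [Ring H] [HopfAlgebra k H] {n : ℕ} {h : H}
    (R : IterRepr k H n h) (h' : H) (e : h' = h) : IterRepr k H n h' where
  ι := R.ι
  s := R.s
  leg := R.leg
  eq := by rw [e, R.eq]

theorem mergeAt_castSucc_last {V : Type} {p : ℕ} (j : Fin p) (x : Fin (p + 2) → V) (v : V) :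
    mergeAt j.castSucc x v (Fin.last p) = x (Fin.last (p + 1)) := by
  have h1 : ¬ p < (j : ℕ) := by omega
  have h2 : ¬ p = (j : ℕ) := by omega
  simp [mergeAt, h1, h2]

theorem mergeAt_succ_cases {V : Type} {p : ℕ} (j : Fin p) (x : Fin (p + 2) → V) (u v : V) :
    mergeAt j.succ (Fin.cases u (fun c : Fin (p + 1) => x c.castSucc) : Fin (p + 2) → V) v =
      Fin.cases u (fun c : Fin p => mergeAt j.castSucc x v c.castSucc) := by
  funext c
  induction c using Fin.cases with
  | zero => simp [mergeAt]
  | succ c => simp [mergeAt]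

/-- Under the standing assumptions, on `H^{⊗(p+2)} ⊗ A^{⊗(q+1)}` and for
`1 ≤ i ≤ P − 1` (here `P = p + 1` and `i = j + 1` with `j : Fin p`) one has
`dᵢ ∘ t = t ∘ d_{i−1}`. -/
theorem face_comp_cyclic_comm
    (k : Type) [Field k] (H : Type) [Ring H] [HopfAlgebra k H]
    (A : Type) [Ring A] [Algebra k A]
    (rho : H →ₗ[k] A →ₗ[k] A) (sg : H →ₗ[k] H →ₗ[k] k)
    (hco : Cocomm k H) (hma : IsModuleAlgebraAction k H A rho)
    (hnorm : NormalKA k H A sg) (hcoc : CocycleKA k H A sg)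
    (htw : TwistedModuleK k H A rho sg) (hinv : ConvInvertibleK k H A sg)
    (p q : ℕ) (j : Fin p)
    (T : ((Tpow k H (p + 1) : Type) ⊗[k] (Tpow k A q : Type)) →ₗ[k]
      ((Tpow k H (p + 1) : Type) ⊗[k] (Tpow k A q : Type)))
    (T' : ((Tpow k H p : Type) ⊗[k] (Tpow k A q : Type)) →ₗ[k]
      ((Tpow k H p : Type) ⊗[k] (Tpow k A q : Type)))
    (Di Dim1 : ((Tpow k H (p + 1) : Type) ⊗[k] (Tpow k A q : Type)) →ₗ[k]
      ((Tpow k H p : Type) ⊗[k] (Tpow k A q : Type)))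
    (hT : IsCycT k H A rho (p + 1) q T)
    (hT' : IsCycT k H A rho p q T')
    (hDi : IsHorFace k H A sg p q j.succ Di)
    (hDim1 : IsHorFace k H A sg p q j.castSucc Dim1) :
    Di ∘ₗ T = T' ∘ₗ Dim1 := by
  refine Tpow.hom_ext_tmul k fun g a => ?_
  obtain ⟨Q⟩ := IterRepr.nonempty k H (q + 1) (g (Fin.last (p + 1)))
  obtain ⟨R⟩ := IterRepr.nonempty k H 1 (g j.castSucc.castSucc)
  obtain ⟨S⟩ := IterRepr.nonempty k H 1 (g j.castSucc.succ)
  rw [LinearMap.comp_apply, LinearMap.comp_apply, hT g a Q, hDim1 g a R S]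
  simp only [map_sum]
  have hL : ∀ r, _ := fun r =>
    hDi (Fin.cases (Q.leg r (Fin.last (q + 1))) (fun c : Fin (p + 1) => g c.castSucc))
      (fun c : Fin (q + 1) => rho (Q.leg r c.castSucc) (a c)) (R.copy _ rfl) (S.copy _ rfl)
  have hR : ∀ r s, _ := fun r s =>
    hT' (mergeAt j.castSucc g (R.leg r 0 * S.leg s 0))
      (Function.update a 0 (sg (R.leg r 1) (S.leg s 1) • a 0))
      (Q.copy _ (mergeAt_castSucc_last j g _))
  simp only [hL, hR, IterRepr.copy]
  rw [Finset.sum_comm]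
  refine Finset.sum_congr rfl fun r _ => ?_
  rw [Finset.sum_comm]
  refine Finset.sum_congr rfl fun s _ => Finset.sum_congr rfl fun t _ => ?_
  rw [mergeAt_succ_cases]
  congr 2
  funext c
  by_cases hc : c = 0
  · subst hc
    simp
  · simp [hc]
end
end

section
/- Under the standing assumptions, for all p,q ≥ 0 the horizontal cyclic operator t and the vertical cyclic operator τ on H^{⊗(p+1)}⊗A^{⊗(q+1)} commute: t ∘ τ = τ ∘ t, where τ(g_0,…,g_p | a_0,…,a_q) = (g_0⁽²⁾,…,g_p⁽²⁾ | S(g_0⁽¹⁾⋯g_p⁽¹⁾)(a_q), a_0,…,a_{q−1}) and t(g_0,…,g_p | a_0,…,a_q) = (g_p^{(q+2)}, g_0,…,g_{p−1} | g_p⁽¹⁾(a_0),…,g_p^{(q+1)}(a_q)). -/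
open TensorProduct

noncomputable section

variable (k : Type) [Field k] (H : Type) [Ring H] [HopfAlgebra k H]

variable (A : Type) [Ring A] [Algebra k A]
variable (rho : H →ₗ[k] A →ₗ[k] A)

variable (sg : H →ₗ[k] H →ₗ[k] k)

section CyclicCommute

open Fin (cons snoc)

section TensorPower

variable {k : Type} [Field k] {V : Type} [AddCommGroup V] [Module k V]

/-- Linear maps out of a tensor power are determined by their values on elementary tensors. -/
theorem Tpow.hom_ext {W : Type} [AddCommGroup W] [Module k W] :
    ∀ {n : ℕ} {f f' : Tpow k V n →ₗ[k] W},
      (∀ v, f (tpow k V n v) = f' (tpow k V n v)) → f = f'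
  | 0, _, _, h => LinearMap.ext fun x => h fun _ => x
  | n + 1, f, f', h => by
    refine TensorProduct.ext (R := k) (M := V) (N := Tpow k V n) (LinearMap.ext fun x => ?_)
    refine Tpow.hom_ext fun v => ?_
    exact h (cons x v)

theorem exists_linearMap_tpow_cons (n : ℕ) (v : Fin n → V) :
    ∃ c : V →ₗ[k] Tpow k V n, ∀ x, c x = tpow k V n (cons x v) := by
  cases n with
  | zero => exact ⟨LinearMap.id, fun x => rfl⟩
  | succ n => exact ⟨(TensorProduct.mk k V (Tpow k V n)).flip (tpow k V n v), fun x => rfl⟩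

end TensorPower

theorem sum_piFinset_cons {X W : Type} [AddCommMonoid W] {n : ℕ}
    (s : Fin (n + 1) → Finset X) (f : (Fin (n + 1) → X) → W) :
    ∑ e ∈ Fintype.piFinset s, f e =
      ∑ z ∈ s 0, ∑ e ∈ Fintype.piFinset fun i : Fin n => s i.succ,
        f (cons (α := fun _ => X) z e) := by
  rw [← Finset.sum_product']
  refine Finset.sum_nbij' (fun e => (e 0, fun i => e i.succ))
    (fun z => cons (α := fun _ => X) z.1 z.2) ?_ ?_ ?_ ?_ ?_
  · intro e he
    simp only [Fintype.mem_piFinset, Finset.mem_product] at he ⊢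
    exact ⟨he 0, fun i => he i.succ⟩
  · intro z hz
    simp only [Fintype.mem_piFinset, Finset.mem_product] at hz ⊢
    exact Fin.cases hz.1 hz.2
  · exact fun e _ => Fin.cons_self_tail e
  · exact fun z _ => rfl
  · exact fun e _ => congrArg f (Fin.cons_self_tail e).symm

theorem sum_piFinset_snoc {X W : Type} [AddCommMonoid W] {n : ℕ}
    (s : Fin (n + 1) → Finset X) (f : (Fin (n + 1) → X) → W) :
    ∑ e ∈ Fintype.piFinset s, f e =
      ∑ e ∈ Fintype.piFinset fun i : Fin n => s i.castSucc, ∑ z ∈ s (Fin.last n),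
        f (snoc (α := fun _ => X) e z) := by
  rw [← Finset.sum_product']
  refine Finset.sum_nbij' (fun e => (fun i => e i.castSucc, e (Fin.last n)))
    (fun z => snoc (α := fun _ => X) z.1 z.2) ?_ ?_ ?_ ?_ ?_
  · intro e he
    simp only [Fintype.mem_piFinset, Finset.mem_product] at he ⊢
    exact ⟨fun i => he i.castSucc, he (Fin.last n)⟩
  · intro z hz
    simp only [Fintype.mem_piFinset, Finset.mem_product] at hz ⊢
    refine Fin.lastCases ?_ fun i => ?_
    · simpa using hz.2
    · simpa using hz.1 i
  · exact fun e _ => Fin.snoc_init_self e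
  · exact fun z _ => by simp
  · exact fun e _ => congrArg f (Fin.snoc_init_self e).symm

section Sweedler

variable (k : Type) [Field k] {H : Type} [Ring H] [HopfAlgebra k H]

/-- A chosen finite index set of pairs `(h⁽¹⁾, h⁽²⁾)` representing `Δ h`. -/
def sweedler (h : H) : Finset (H × H) := (Coalgebra.Repr.arbitrary k h).index

theorem sum_sweedler (h : H) :
    ∑ z ∈ sweedler k h, z.1 ⊗ₜ[k] z.2 = Coalgebra.comul (R := k) h :=
  (Coalgebra.Repr.arbitrary k h).eq

/-- The chosen representation of `Δ h`. -/
def IterRepr.ofSweedler (h : H) : IterRepr k H 1 h where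
  ι := H × H
  s := sweedler k h
  leg z := ![z.1, z.2]
  eq := by
    refine (sum_sweedler k h).trans ?_
    exact (LinearMap.congr_fun (LinearMap.lTensor_id (R := k) H H) _).symm

variable {k}

/-- Splitting off the first leg: `Δ⁽ⁿ⁺¹⁾ = (1 ⊗ Δ⁽ⁿ⁾) ∘ Δ`. -/
def IterRepr.split {n : ℕ} (R : ∀ h : H, IterRepr k H n h) (h : H) :
    IterRepr k H (n + 1) h where
  ι := Σ z : H × H, (R z.2).ι
  s := (sweedler k h).sigma fun z => (R z.2).s
  leg x := cons x.1.1 ((R x.1.2).leg x.2)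
  eq := by
    rw [Finset.sum_sigma]
    change _ = LinearMap.lTensor H (comulIter k H n) (Coalgebra.comul h)
    rw [← sum_sweedler, map_sum]
    refine Finset.sum_congr rfl fun z _ => ?_
    rw [LinearMap.lTensor_tmul, ← (R z.2).eq, TensorProduct.tmul_sum]
    rfl

theorem nonempty_iterRepr : ∀ (n : ℕ) (h : H), Nonempty (IterRepr k H n h)
  | 0, h => ⟨⟨Unit, {()}, fun _ _ => h, Finset.sum_singleton _ _⟩⟩
  | n + 1, h => ⟨IterRepr.split (fun h => (nonempty_iterRepr n h).some) h⟩

/-- `Δ⁽ⁿ⁺¹⁾ = (1 ⊗ ⋯ ⊗ 1 ⊗ Δ) ∘ Δ⁽ⁿ⁾`, where `1 ⊗ ⋯ ⊗ 1 ⊗ Δ` is given on elementary tensors. -/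
theorem exists_comul_last (n : ℕ) :
    ∃ J : Tpow k H n →ₗ[k] Tpow k H (n + 1),
      J ∘ₗ comulIter k H n = comulIter k H (n + 1) ∧
      ∀ f : Fin (n + 1) → H, J (tpow k H n f) =
        ∑ z ∈ sweedler k (f (Fin.last n)),
          tpow k H (n + 1) (snoc (α := fun _ => H)
            (snoc (α := fun _ => H) (fun i : Fin n => f i.castSucc) z.1) z.2) := by
  induction n with
  | zero =>
    refine ⟨(Coalgebra.comul : H →ₗ[k] H ⊗[k] H), ?_, fun f => ?_⟩
    · exact LinearMap.ext fun h =>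
        (LinearMap.congr_fun (LinearMap.lTensor_id (R := k) H H) _).symm
    · exact (sum_sweedler k (f 0)).symm
  | succ n ih =>
    obtain ⟨J, hJ, hf⟩ := ih
    refine ⟨(LinearMap.lTensor H J : H ⊗[k] Tpow k H n →ₗ[k] H ⊗[k] Tpow k H (n + 1)), ?_,
      fun f => ?_⟩
    · refine LinearMap.ext fun h => ?_
      change LinearMap.lTensor H J (LinearMap.lTensor H (comulIter k H n) (Coalgebra.comul h)) =
        LinearMap.lTensor H (comulIter k H (n + 1)) (Coalgebra.comul h)
      rw [← LinearMap.comp_apply, ← LinearMap.lTensor_comp, hJ]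
    · change LinearMap.lTensor H J (f 0 ⊗ₜ[k] tpow k H n fun i => f i.succ) = _
      rw [LinearMap.lTensor_tmul, hf, TensorProduct.tmul_sum]
      refine Finset.sum_congr rfl fun z _ => ?_
      change (f 0 ⊗ₜ[k] tpow k H (n + 1) _ : H ⊗[k] Tpow k H (n + 1)) =
        (_ ⊗ₜ[k] tpow k H (n + 1) _ : H ⊗[k] Tpow k H (n + 1))
      congr 2
      funext i
      refine Fin.lastCases ?_ (fun i => ?_) i
      · rw [Fin.succ_last]; simp only [Fin.snoc_last]
      · rw [Fin.succ_castSucc]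
        simp only [Fin.snoc_castSucc]
        refine Fin.lastCases ?_ (fun i => ?_) i
        · rw [Fin.succ_last]; simp only [Fin.snoc_last]
        · rw [Fin.succ_castSucc]; simp only [Fin.snoc_castSucc, Fin.succ_castSucc]

/-- Splitting the last leg: `Δ⁽ⁿ⁺¹⁾ = (1 ⊗ ⋯ ⊗ 1 ⊗ Δ) ∘ Δ⁽ⁿ⁾`. -/
def IterRepr.splitLast {n : ℕ} {h : H} (R : IterRepr k H n h) : IterRepr k H (n + 1) h where
  ι := R.ι × (H × H)
  s := R.s.sigma (fun r => sweedler k (R.leg r (Fin.last n))) |>.map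
    (Equiv.sigmaEquivProd R.ι (H × H)).toEmbedding
  leg x := snoc (α := fun _ => H)
    (snoc (α := fun _ => H) (fun i : Fin n => R.leg x.1 i.castSucc) x.2.1) x.2.2
  eq := by
    obtain ⟨J, hJ, hf⟩ := exists_comul_last (k := k) (H := H) n
    rw [Finset.sum_map, Finset.sum_sigma, ← hJ, LinearMap.comp_apply, ← R.eq, map_sum]
    exact Finset.sum_congr rfl fun r _ => (hf _).symm

theorem sum_sweedler_cancel {W : Type} [AddCommGroup W] [Module k W]
    (m : H →ₗ[k] H →ₗ[k] H)
    (hm : ∀ h, ∑ z ∈ sweedler k h, m z.1 z.2 = Coalgebra.counit (R := k) h • (1 : H))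
    (F : H →ₗ[k] H →ₗ[k] W) (h : H) :
    ∑ z ∈ sweedler k h, ∑ w ∈ sweedler k z.2, F (m z.1 w.1) w.2 = F 1 h := by
  have key := congrArg (TensorProduct.lift F ∘ₗ (TensorProduct.lift m).rTensor H ∘ₗ
    (TensorProduct.assoc k H H H).symm.toLinearMap)
    (Coalgebra.sum_tmul_tmul_eq (Coalgebra.Repr.arbitrary k h)
      (fun z => Coalgebra.Repr.arbitrary k _) (fun z => Coalgebra.Repr.arbitrary k _))
  simp only [map_sum, LinearMap.comp_apply, LinearEquiv.coe_coe, TensorProduct.assoc_symm_tmul,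
    LinearMap.rTensor_tmul, TensorProduct.lift.tmul] at key
  refine key.symm.trans ?_
  have inner : ∀ z : H × H, ∑ w ∈ sweedler k z.1, F (m w.1 w.2) z.2 =
      F 1 (Coalgebra.counit (R := k) z.1 • z.2) := fun z => by
    rw [← LinearMap.sum_apply, ← map_sum, hm, map_smul, map_smul, LinearMap.smul_apply]
  refine (Finset.sum_congr rfl fun z _ => inner z).trans ?_
  rw [← map_sum]
  exact congrArg _ (Coalgebra.sum_counit_smul (Coalgebra.Repr.arbitrary k h))

theorem sum_sweedler_swap (hco : Cocomm k H) {W : Type} [AddCommGroup W] [Module k W]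
    (F : H →ₗ[k] H →ₗ[k] W) (h : H) :
    ∑ z ∈ sweedler k h, F z.2 z.1 = ∑ z ∈ sweedler k h, F z.1 z.2 := by
  have := congrArg (TensorProduct.lift F) (hco h)
  rw [← sum_sweedler] at this
  simpa only [map_sum, TensorProduct.comm_tmul, TensorProduct.lift.tmul] using this

theorem sum_mul_antipode_cancel (hco : Cocomm k H) {W : Type} [AddCommGroup W] [Module k W]
    (F : H →ₗ[k] H →ₗ[k] W) (h : H) :
    ∑ z ∈ sweedler k h, ∑ w ∈ sweedler k z.2,
      F (w.1 * HopfAlgebra.antipode (R := k) z.1) w.2 = F 1 h := by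
  refine sum_sweedler_cancel
    ((LinearMap.mul k H).flip ∘ₗ HopfAlgebra.antipode k (A := H)) (fun h => ?_) F h
  refine (sum_sweedler_swap hco
    ((LinearMap.mul k H).compl₂ (HopfAlgebra.antipode k (A := H))) h).trans ?_
  exact HopfAlgebra.sum_mul_antipode_eq_smul (Coalgebra.Repr.arbitrary k h)

theorem sum_antipode_mul_cancel (hco : Cocomm k H) {W : Type} [AddCommGroup W] [Module k W]
    (F : H →ₗ[k] H →ₗ[k] W) (h : H) :
    ∑ z ∈ sweedler k h, ∑ w ∈ sweedler k z.2,
      F (HopfAlgebra.antipode (R := k) w.1 * z.1) w.2 = F 1 h := by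
  refine sum_sweedler_cancel
    ((LinearMap.mul k H ∘ₗ HopfAlgebra.antipode k (A := H)).flip) (fun h => ?_) F h
  refine (sum_sweedler_swap hco
    (LinearMap.mul k H ∘ₗ HopfAlgebra.antipode k (A := H)) h).trans ?_
  exact HopfAlgebra.sum_antipode_mul_eq_smul (Coalgebra.Repr.arbitrary k h)

end Sweedler

section Action

variable {k : Type} [Field k] {H : Type} [Ring H] [HopfAlgebra k H]
variable {A : Type} [Ring A] [Algebra k A] (rho : H →ₗ[k] A →ₗ[k] A)

/-- All but the last leg act on the entries of `a`; the last leg is kept. -/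
theorem exists_linearMap_act (n : ℕ) (a : Fin n → A) :
    ∃ B : A →ₗ[k] Tpow k H n →ₗ[k] (Tpow k A n : Type) ⊗[k] H,
      ∀ (w : A) (f : Fin (n + 1) → H), B w (tpow k H n f) =
        tpow k A n (cons (α := fun _ => A) w fun i => rho (f i.castSucc) (a i)) ⊗ₜ[k]
          f (Fin.last n) := by
  induction n with
  | zero => exact ⟨TensorProduct.mk k A H, fun w f => rfl⟩
  | succ n ih =>
    obtain ⟨B, hB⟩ := ih fun i => a i.succ
    let L : H ⊗[k] Tpow k H n →ₗ[k] (Tpow k A n : Type) ⊗[k] H :=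
      TensorProduct.lift (B ∘ₗ rho.flip (a 0))
    refine ⟨(((TensorProduct.mk k A ((Tpow k A n : Type) ⊗[k] H)).compl₂ L).compr₂
      (TensorProduct.assoc k A (Tpow k A n) H).symm.toLinearMap :
        A →ₗ[k] H ⊗[k] Tpow k H n →ₗ[k] (A ⊗[k] (Tpow k A n : Type)) ⊗[k] H), fun w f => ?_⟩
    change (TensorProduct.assoc k A (Tpow k A n) H).symm
      (w ⊗ₜ[k] B (rho (f 0) (a 0)) (tpow k H n fun i => f i.succ)) = _
    rw [hB, TensorProduct.assoc_symm_tmul]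
    change ((w ⊗ₜ[k] tpow k A n _ : A ⊗[k] (Tpow k A n : Type)) ⊗ₜ[k] _ :
      (A ⊗[k] (Tpow k A n : Type)) ⊗[k] H) =
      ((w ⊗ₜ[k] tpow k A n _ : A ⊗[k] (Tpow k A n : Type)) ⊗ₜ[k] _)
    congr 3
    funext i
    refine Fin.cases rfl (fun i => rfl) i

end Action

section Main

variable {k : Type} [Field k] {H : Type} [Ring H] [HopfAlgebra k H]
variable {A : Type} [Ring A] [Algebra k A] {rho : H →ₗ[k] A →ₗ[k] A} {p q : ℕ}
variable {T : ((Tpow k H p : Type) ⊗[k] (Tpow k A q : Type)) →ₗ[k]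
  ((Tpow k H p : Type) ⊗[k] (Tpow k A q : Type))}

theorem IsCycT.apply_cons (hT : IsCycT k H A rho p q T) {g : Fin (p + 1) → H} {x : H}
    (hg : g (Fin.last p) = x) (w : A) (a : Fin q → A) (R : IterRepr k H (q + 1) x) :
    T (tpow k H p g ⊗ₜ[k] tpow k A q (cons (α := fun _ => A) w a)) =
      ∑ r ∈ R.s,
        tpow k H p (cons (α := fun _ => H) (R.leg r (Fin.last (q + 1))) fun j => g j.castSucc)
          ⊗ₜ[k]
        tpow k A q (cons (α := fun _ => A) (rho (R.leg r 0) w)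
          fun c => rho (R.leg r c.succ.castSucc) (a c)) := by
  subst hg
  refine (hT g _ R).trans (Finset.sum_congr rfl fun r _ => ?_)
  congr 2
  funext c
  exact Fin.cases rfl (fun c => rfl) c

theorem IsCycT.apply_snoc (hT : IsCycT k H A rho p q T) (g : Fin (p + 1) → H)
    (a : Fin (q + 1) → A) (R : IterRepr k H q (g (Fin.last p))) :
    T (tpow k H p g ⊗ₜ[k] tpow k A q a) =
      ∑ r ∈ R.s, ∑ z ∈ sweedler k (R.leg r (Fin.last q)),
        tpow k H p (cons (α := fun _ => H) z.2 fun j => g j.castSucc) ⊗ₜ[k]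
        tpow k A q (snoc (α := fun _ => A)
          (fun c => rho (R.leg r c.castSucc) (a c.castSucc)) (rho z.1 (a (Fin.last q)))) := by
  refine (hT g a R.splitLast).trans ?_
  simp only [IterRepr.splitLast, Finset.sum_map, Finset.sum_sigma]
  refine Finset.sum_congr rfl fun r _ => Finset.sum_congr rfl fun z _ => ?_
  congr 2
  · simp only [Fin.snoc_last]
    rfl
  · funext c
    refine Fin.lastCases ?_ (fun c => ?_) c
    · simp
    · simp

theorem IsCycTau.apply (hT : IsCycTau k H A rho p q T) (g : Fin (p + 1) → H)
    (a : Fin (q + 1) → A) :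
    T (tpow k H p g ⊗ₜ[k] tpow k A q a) =
      ∑ e ∈ Fintype.piFinset fun i => sweedler k (g i),
        tpow k H p (fun i => (e i).2) ⊗ₜ[k]
        tpow k A q (cons (α := fun _ => A)
          (rho (HopfAlgebra.antipode (R := k) (List.ofFn fun i => (e i).1).prod)
            (a (Fin.last q)))
          fun c => a c.castSucc) :=
  hT g a fun i => IterRepr.ofSweedler k (g i)

/-- The common value of `t ∘ τ` and `τ ∘ t` on elementary tensors. -/
def cyclicComposite (rho : H →ₗ[k] A →ₗ[k] A) (g : Fin (p + 1) → H) (a : Fin (q + 1) → A)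
    (R : IterRepr k H q (g (Fin.last p))) : (Tpow k H p : Type) ⊗[k] (Tpow k A q : Type) :=
  ∑ e ∈ Fintype.piFinset fun i : Fin p => sweedler k (g i.castSucc), ∑ r ∈ R.s,
    tpow k H p (cons (α := fun _ => H) (R.leg r (Fin.last q)) fun i => (e i).2) ⊗ₜ[k]
    tpow k A q (cons (α := fun _ => A)
      (rho (HopfAlgebra.antipode (R := k) (List.ofFn fun i => (e i).1).prod) (a (Fin.last q)))
      fun c => rho (R.leg r c.castSucc) (a c.castSucc))

theorem cycT_cycTau_apply (hco : Cocomm k H)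
    {Tau : ((Tpow k H p : Type) ⊗[k] (Tpow k A q : Type)) →ₗ[k]
      ((Tpow k H p : Type) ⊗[k] (Tpow k A q : Type))}
    (hmul : ∀ (h l : H) (a : A), rho (h * l) a = rho h (rho l a))
    (hone : ∀ a : A, rho 1 a = a)
    (hT : IsCycT k H A rho p q T) (hTau : IsCycTau k H A rho p q Tau)
    (g : Fin (p + 1) → H) (a : Fin (q + 1) → A) (R : IterRepr k H q (g (Fin.last p))) :
    T (Tau (tpow k H p g ⊗ₜ[k] tpow k A q a)) = cyclicComposite rho g a R := by
  rw [hTau.apply, map_sum, sum_piFinset_snoc, cyclicComposite]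
  refine Finset.sum_congr rfl fun e _ => ?_
  obtain ⟨c, hc⟩ := exists_linearMap_tpow_cons (k := k) p fun i => (e i).2
  obtain ⟨B, hB⟩ := exists_linearMap_act rho q fun i => a i.castSucc
  let y := rho (HopfAlgebra.antipode (R := k) (List.ofFn fun i => (e i).1).prod) (a (Fin.last q))
  let D : (Tpow k A q : Type) ⊗[k] H →ₗ[k] (Tpow k H p : Type) ⊗[k] (Tpow k A q : Type) :=
    (TensorProduct.comm k (Tpow k A q) (Tpow k H p)).toLinearMap ∘ₗ c.lTensor (Tpow k A q)
  let F : H →ₗ[k] H →ₗ[k] (Tpow k H p : Type) ⊗[k] (Tpow k A q : Type) :=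
    ((B ∘ₗ rho.flip y).compl₂ (comulIter k H q)).compr₂ D
  have hF : ∀ (s x : H) (R : IterRepr k H q x), F s x = ∑ r ∈ R.s,
      tpow k H p (cons (α := fun _ => H) (R.leg r (Fin.last q)) fun i => (e i).2) ⊗ₜ[k]
      tpow k A q (cons (α := fun _ => A) (rho s y)
        fun c => rho (R.leg r c.castSucc) (a c.castSucc)) := fun s x R => by
    change D (B (rho s y) (comulIter k H q x)) = _
    rw [← R.eq, map_sum, map_sum]
    refine Finset.sum_congr rfl fun r _ => ?_
    rw [hB]
    change TensorProduct.comm k _ _ (_ ⊗ₜ[k] c _) = _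
    rw [TensorProduct.comm_tmul, hc]
    rfl
  have hend := hF 1 (g (Fin.last p)) R
  rw [hone] at hend
  rw [← hend, ← sum_mul_antipode_cancel hco F]
  refine Finset.sum_congr rfl fun z _ => ?_
  let R' : ∀ h : H, IterRepr k H q h := fun h => (nonempty_iterRepr q h).some
  rw [hT.apply_cons (x := z.2) (by simp) _ _ (IterRepr.split R' z.2)]
  simp only [IterRepr.split, Finset.sum_sigma]
  refine Finset.sum_congr rfl fun w _ => ?_
  rw [hF _ _ (R' w.2)]
  refine Finset.sum_congr rfl fun r _ => ?_
  congr 2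
  · congr 1
    · funext j
      simp
  · congr 1
    rw [List.ofFn_succ']
    simp [hmul, HopfAlgebra.antipode_mul_antidistrib, y]

theorem cycTau_cycT_apply (hco : Cocomm k H)
    {Tau : ((Tpow k H p : Type) ⊗[k] (Tpow k A q : Type)) →ₗ[k]
      ((Tpow k H p : Type) ⊗[k] (Tpow k A q : Type))}
    (hmul : ∀ (h l : H) (a : A), rho (h * l) a = rho h (rho l a))
    (hone : ∀ a : A, rho 1 a = a)
    (hT : IsCycT k H A rho p q T) (hTau : IsCycTau k H A rho p q Tau)
    (g : Fin (p + 1) → H) (a : Fin (q + 1) → A) (R : IterRepr k H q (g (Fin.last p))) :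
    Tau (T (tpow k H p g ⊗ₜ[k] tpow k A q a)) = cyclicComposite rho g a R := by
  rw [hT.apply_snoc g a R, map_sum, cyclicComposite, Finset.sum_comm]
  refine Finset.sum_congr rfl fun r _ => ?_
  let u : (Fin p → H × H) → A →ₗ[k] A := fun e =>
    rho (HopfAlgebra.antipode (R := k) (List.ofFn fun i => (e i).1).prod)
  obtain ⟨d, hd⟩ := exists_linearMap_tpow_cons (k := k) q
    fun c => rho (R.leg r c.castSucc) (a c.castSucc)
  choose c hc using fun e : Fin p → H × H =>
    exists_linearMap_tpow_cons (k := k) p fun i => (e i).2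
  let F : (Fin p → H × H) → H →ₗ[k] H →ₗ[k]
      (Tpow k H p : Type) ⊗[k] (Tpow k A q : Type) := fun e =>
    ((TensorProduct.mk k (Tpow k H p) (Tpow k A q)).flip.compl₂ (c e)) ∘ₗ
      (d ∘ₗ u e ∘ₗ rho.flip (a (Fin.last q)))
  have hF : ∀ e s x, F e s x =
      tpow k H p (cons (α := fun _ => H) x fun i => (e i).2) ⊗ₜ[k]
      tpow k A q (cons (α := fun _ => A) (u e (rho s (a (Fin.last q))))
        fun c => rho (R.leg r c.castSucc) (a c.castSucc)) := fun e s x => by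
    change c e x ⊗ₜ[k] d _ = _
    rw [hc, hd]
    rfl
  have hend : ∀ e, F e 1 (R.leg r (Fin.last q)) = _ := fun e => hF e 1 _
  simp only [hone] at hend
  refine Eq.trans ?_ (Finset.sum_congr rfl fun e _ => hend e)
  simp only [← sum_antipode_mul_cancel hco]
  rw [map_sum, Finset.sum_comm]
  refine Finset.sum_congr rfl fun z _ => ?_
  rw [hTau.apply, sum_piFinset_cons, Finset.sum_comm]
  refine Finset.sum_congr rfl fun e _ => Finset.sum_congr rfl fun w _ => ?_
  rw [hF]
  congr 2
  · funext i
    refine Fin.cases rfl (fun i => rfl) i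
  · congr 1
    · simp [hmul, HopfAlgebra.antipode_mul_antidistrib, u, List.ofFn_succ]
    · funext i
      simp

end Main

end CyclicCommute

/-- Under the standing assumptions, the horizontal cyclic operator `t` and
the vertical cyclic operator `τ` on `H^{⊗(p+1)} ⊗ A^{⊗(q+1)}` commute: `t ∘ τ = τ ∘ t`. -/
theorem cyclic_operators_commute
    (k : Type) [Field k] (H : Type) [Ring H] [HopfAlgebra k H]
    (A : Type) [Ring A] [Algebra k A]
    (rho : H →ₗ[k] A →ₗ[k] A) (sg : H →ₗ[k] H →ₗ[k] k)
    (hco : Cocomm k H) (hma : IsModuleAlgebraAction k H A rho)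
    (hnorm : NormalKA k H A sg) (hcoc : CocycleKA k H A sg)
    (htw : TwistedModuleK k H A rho sg) (hinv : ConvInvertibleK k H A sg)
    (p q : ℕ)
    (T Tau : ((Tpow k H p : Type) ⊗[k] (Tpow k A q : Type)) →ₗ[k]
      ((Tpow k H p : Type) ⊗[k] (Tpow k A q : Type)))
    (hT : IsCycT k H A rho p q T)
    (hTau : IsCycTau k H A rho p q Tau) :
    T ∘ₗ Tau = Tau ∘ₗ T := by
  refine TensorProduct.ext (Tpow.hom_ext fun g => Tpow.hom_ext fun a => ?_)
  obtain ⟨R⟩ := nonempty_iterRepr (k := k) q (g (Fin.last p))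
  exact (cycT_cycTau_apply hco hma.2 hma.1.2.2 hT hTau g a R).trans
    (cycTau_cycT_apply hco hma.2 hma.1.2.2 hT hTau g a R).symm
end
end
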